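/- arXiv:2602.08618 — 2 statements merged into one kernel-verified Lean document; each statement's English description precedes it below -/
import Mathlib

section
/- Let f : ℝ^n → ℝ be L-smooth convex for some L > 0, let r > 0, and let (x, z) be a solution of the NAG ODE with parameter r and initial point x₀. Define q(t) := −(2(r+2)/t²)(x(t) − x₀) for t > 0. Then: (a) q(t) ∈ dom f* for all t > 0; (b) if p⋆ ∈ dom f* (i.e., dom f* has a minimum-norm point), then for all t > 0, ‖q(t) − p⋆‖² ≤ 8(r+2)²·D_f(x₀, p⋆)/t². -/
open scoped InnerProductSpace
open Filter Topology

/-- Legendre–Fenchel conjugate of `f`, valued in `ℝ ∪ {∞}` (modeled in `EReal`). -/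
noncomputable def fconj {n : ℕ} (f : EuclideanSpace ℝ (Fin n) → ℝ)
    (p : EuclideanSpace ℝ (Fin n)) : EReal :=
  ⨆ x : EuclideanSpace ℝ (Fin n), ((⟪p, x⟫_ℝ - f x : ℝ) : EReal)

/-- Effective domain `dom f*` of the Legendre–Fenchel conjugate. -/
noncomputable def fconjDom {n : ℕ} (f : EuclideanSpace ℝ (Fin n) → ℝ) :
    Set (EuclideanSpace ℝ (Fin n)) := {p | fconj f p < ⊤}

/-- Dual divergence `D_f(x, p) = f x + f*(p) − ⟨p, x⟩` (meaningful for `p ∈ dom f*`). -/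
noncomputable def dualDiv {n : ℕ} (f : EuclideanSpace ℝ (Fin n) → ℝ)
    (x p : EuclideanSpace ℝ (Fin n)) : ℝ :=
  f x + (fconj f p).toReal - ⟪p, x⟫_ℝ

/-- `f` is `L`-smooth convex: convex, differentiable, with `L`-Lipschitz gradient. -/
def LSmoothConvex {n : ℕ} (L : ℝ) (f : EuclideanSpace ℝ (Fin n) → ℝ) : Prop :=
  ConvexOn ℝ Set.univ f ∧ Differentiable ℝ f ∧
    LipschitzWith (Real.toNNReal L) (fun x => gradient f x)

theorem mem_fconjDom_of_forall_le {n : ℕ} {f : EuclideanSpace ℝ (Fin n) → ℝ}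
    {p : EuclideanSpace ℝ (Fin n)} {M : ℝ} (h : ∀ y, ⟪p, y⟫_ℝ - f y ≤ M) :
    p ∈ fconjDom f :=
  lt_of_le_of_lt (iSup_le fun y => EReal.coe_le_coe_iff.2 (h y)) (EReal.coe_lt_top M)

theorem inner_sub_le_toReal_fconj {n : ℕ} {f : EuclideanSpace ℝ (Fin n) → ℝ}
    {p : EuclideanSpace ℝ (Fin n)} (hp : p ∈ fconjDom f) (y : EuclideanSpace ℝ (Fin n)) :
    ⟪p, y⟫_ℝ - f y ≤ (fconj f p).toReal := by
  have h : ((⟪p, y⟫_ℝ - f y : ℝ) : EReal) ≤ fconj f p :=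
    le_iSup (fun y => ((⟪p, y⟫_ℝ - f y : ℝ) : EReal)) y
  have h1 : fconj f p ≠ ⊤ := ne_of_lt hp
  have h2 : fconj f p ≠ ⊥ := fun hb => EReal.coe_ne_bot _ (le_bot_iff.1 (hb ▸ h))
  rwa [← EReal.coe_toReal h1 h2, EReal.coe_le_coe_iff] at h

theorem dualDiv_nonneg {n : ℕ} {f : EuclideanSpace ℝ (Fin n) → ℝ}
    {p : EuclideanSpace ℝ (Fin n)} (hp : p ∈ fconjDom f) (y : EuclideanSpace ℝ (Fin n)) :
    0 ≤ dualDiv f y p := by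
  have := inner_sub_le_toReal_fconj hp y
  unfold dualDiv
  linarith

theorem convex_fconjDom {n : ℕ} (f : EuclideanSpace ℝ (Fin n) → ℝ) :
    Convex ℝ (fconjDom f) := by
  intro p hp q hq a b ha hb hab
  refine mem_fconjDom_of_forall_le
    (M := a * (fconj f p).toReal + b * (fconj f q).toReal) fun y => ?_
  have h1 := mul_le_mul_of_nonneg_left (inner_sub_le_toReal_fconj hp y) ha
  have h2 := mul_le_mul_of_nonneg_left (inner_sub_le_toReal_fconj hq y) hb
  rw [inner_add_left, real_inner_smul_left, real_inner_smul_left]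
  have h3 : f y = a * f y + b * f y := by rw [← add_mul, hab, one_mul]
  linarith

/-- Chain rule for a function with a gradient composed with a differentiable curve. -/
theorem HasGradientAt.comp_hasDerivAt_inner {F : Type*} [NormedAddCommGroup F]
    [InnerProductSpace ℝ F] [CompleteSpace F] {f : F → ℝ} {g v : F} {c : ℝ → F} {t : ℝ}
    (hf : HasGradientAt f g (c t)) (hc : HasDerivAt c v t) :
    HasDerivAt (fun s => f (c s)) ⟪g, v⟫_ℝ t := by
  simpa [Function.comp_def] using hf.hasFDerivAt.comp_hasDerivAt t hc

/-- The gradient inequality for a convex function. -/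
theorem ConvexOn.inner_le_sub_of_hasGradientAt {F : Type*} [NormedAddCommGroup F]
    [InnerProductSpace ℝ F] [CompleteSpace F] {f : F → ℝ} (hf : ConvexOn ℝ Set.univ f)
    {g x : F} (hg : HasGradientAt f g x) (y : F) : ⟪g, y - x⟫_ℝ ≤ f y - f x := by
  have hc : ConvexOn ℝ Set.univ (fun s : ℝ => f (AffineMap.lineMap x y s)) := by
    exact hf.comp_affineMap (AffineMap.lineMap (k := ℝ) x y)
  have hd : HasDerivAt (fun s : ℝ => f (AffineMap.lineMap x y s)) ⟪g, y - x⟫_ℝ 0 :=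
    HasGradientAt.comp_hasDerivAt_inner (g := g) (by simpa using hg) AffineMap.hasDerivAt_lineMap
  simpa [slope_def_field] using
    hc.le_slope_of_hasDerivAt (Set.mem_univ _) (Set.mem_univ _) zero_lt_one hd

/-- Variational inequality for a minimum-norm point of a convex set. -/
theorem Convex.inner_sub_nonneg_of_norm_le {F : Type*} [NormedAddCommGroup F]
    [InnerProductSpace ℝ F] {K : Set F} (hK : Convex ℝ K) {p : F} (hp : p ∈ K)
    (hmin : ∀ q ∈ K, ‖p‖ ≤ ‖q‖) {q : F} (hq : q ∈ K) : 0 ≤ ⟪q - p, p⟫_ℝ := by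
  have : Nonempty K := ⟨⟨p, hp⟩⟩
  have h : ‖(0 : F) - p‖ = ⨅ w : K, ‖(0 : F) - w‖ := by
    refine le_antisymm (le_ciInf fun w => by simpa using hmin w w.2) ?_
    exact ciInf_le (f := fun w : K => ‖(0 : F) - w‖)
      ⟨0, by rintro _ ⟨w, rfl⟩; exact norm_nonneg _⟩ ⟨p, hp⟩
  have := (norm_eq_iInf_iff_real_inner_le_zero hK hp).1 h q hq
  rw [zero_sub, inner_neg_left, real_inner_comm] at this
  linarith

/-- Linear functionals bounded by `b` along the driving term of the NAG ODE stay bounded by `b`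
on the corresponding weighted average, which is a rescaled displacement of the solution. -/
theorem nag_inner_sub_add_nonneg {F : Type*} [NormedAddCommGroup F] [InnerProductSpace ℝ F]
    {r : ℝ} (hr : 0 < r) {x z x' z' g : ℝ → F} {T : ℝ} (hT : 0 < T) {x₀ y : F}
    {b : ℝ} (hxc : ContinuousOn x (Set.Ici 0)) (hzc : ContinuousOn z (Set.Ici 0))
    (hxd : ∀ t > 0, HasDerivAt x (x' t) t) (hzd : ∀ t > 0, HasDerivAt z (z' t) t)
    (hx0 : x 0 = x₀) (hz0 : z 0 = x₀)
    (hode1 : ∀ t > (0 : ℝ), x' t = (r / t) • (z t - x t))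
    (hode2 : ∀ t > (0 : ℝ), z' t = -((t / r) • g t))
    (hb : ∀ s ∈ Set.Ioo 0 T, ⟪g s, y⟫_ℝ ≤ b) :
    0 ≤ ⟪x T - x₀, y⟫_ℝ + T ^ 2 / (2 * (r + 2)) * b := by
  have hsub : Set.Icc 0 T ⊆ Set.Ici 0 := Set.Icc_subset_Ici_self
  have hzy : ∀ s ∈ Set.Icc 0 T, 0 ≤ ⟪z s - x₀, y⟫_ℝ + s ^ 2 / (2 * r) * b := by
    have hmono : MonotoneOn (fun s => ⟪z s - x₀, y⟫_ℝ + s ^ 2 / (2 * r) * b)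
        (Set.Icc 0 T) := by
      refine monotoneOn_of_hasDerivWithinAt_nonneg (convex_Icc 0 T)
        (f' := fun s => ⟪z' s, y⟫_ℝ + s / r * b) ?_ ?_ ?_
      · exact (((hzc.mono hsub).sub continuousOn_const).inner continuousOn_const).add
          (by fun_prop)
      · intro s hs
        rw [interior_Icc] at hs
        have h1 := ((hzd s hs.1).sub_const x₀).inner ℝ (hasDerivAt_const s y)
        have h2 := (((hasDerivAt_id s).pow 2).div_const (2 * r)).mul_const b
        refine ((h1.add h2).congr_deriv ?_).hasDerivWithinAt
        simp only [id, inner_zero_right, zero_add]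
        push_cast
        field_simp
      · intro s hs
        rw [interior_Icc] at hs
        rw [hode2 s hs.1, inner_neg_left, real_inner_smul_left]
        have := mul_nonneg (div_pos hs.1 hr).le (sub_nonneg.2 (hb s hs))
        linarith
    intro s hs
    simpa [hz0] using hmono ⟨le_rfl, hT.le⟩ hs hs.1
  have hxy : 0 ≤ T ^ r * (⟪x T - x₀, y⟫_ℝ + T ^ 2 / (2 * (r + 2)) * b) := by
    have hmono : MonotoneOn
        (fun s => s ^ r * (⟪x s - x₀, y⟫_ℝ + s ^ 2 / (2 * (r + 2)) * b))
        (Set.Icc 0 T) := by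
      refine monotoneOn_of_hasDerivWithinAt_nonneg (convex_Icc 0 T)
        (f' := fun s => s ^ r * (r / s) *
          (⟪z s - x₀, y⟫_ℝ + s ^ 2 / (2 * r) * b)) ?_ ?_ ?_
      · refine (Real.continuous_rpow_const hr.le).continuousOn.mul ?_
        exact (((hxc.mono hsub).sub continuousOn_const).inner continuousOn_const).add
          (by fun_prop)
      · intro s hs
        rw [interior_Icc] at hs
        have hs0 : s ≠ 0 := hs.1.ne'
        have h0 := Real.hasDerivAt_rpow_const (p := r) (Or.inl hs0)
        have h1 := ((hxd s hs.1).sub_const x₀).inner ℝ (hasDerivAt_const s y)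
        have h2 := (((hasDerivAt_id s).pow 2).div_const (2 * (r + 2))).mul_const b
        refine ((h0.mul (h1.add h2)).congr_deriv ?_).hasDerivWithinAt
        rw [Real.rpow_sub_one hs0, hode1 s hs.1]
        simp [inner_sub_left, real_inner_smul_left]
        field_simp
        ring
      · intro s hs
        rw [interior_Icc] at hs
        have hs0 : 0 < s := hs.1
        exact mul_nonneg (by positivity) (hzy s ⟨hs.1.le, hs.2.le⟩)
    have := hmono ⟨le_rfl, hT.le⟩ ⟨hT.le, le_rfl⟩ hT.le
    simpa [hx0] using this
  exact nonneg_of_mul_nonneg_right hxy (Real.rpow_pos_of_pos hT r)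

/-- A solution of the NAG ODE that starts with both components equal has zero initial
velocity. -/
theorem nag_initial_velocity_eq_zero {F : Type*} [NormedAddCommGroup F] [InnerProductSpace ℝ F]
    {r : ℝ} (hr : 0 < r) {x z x' z' g : ℝ → F}
    (hx : HasDerivWithinAt x (x' 0) (Set.Ici 0) 0) (hz : HasDerivWithinAt z (z' 0) (Set.Ici 0) 0)
    (hx' : ContinuousOn x' (Set.Ici 0)) (hz' : ContinuousOn z' (Set.Ici 0)) (hxz : x 0 = z 0)
    (hgc : ContinuousOn g (Set.Ici 0))
    (hode1 : ∀ t > (0 : ℝ), x' t = (r / t) • (z t - x t))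
    (hode2 : ∀ t > (0 : ℝ), z' t = -((t / r) • g t)) : x' 0 = 0 := by
  have hz'0 : z' 0 = 0 := by
    have h1 : Tendsto z' (𝓝[>] 0) (𝓝 (z' 0)) :=
      (hz' 0 Set.self_mem_Ici).mono_left (nhdsWithin_mono _ Set.Ioi_subset_Ici_self)
    have h2 : Tendsto (fun t => -((t / r) • g t)) (𝓝[>] 0) (𝓝 0) := by
      have h3 : ContinuousOn (fun t => -((t / r) • g t)) (Set.Ici 0) :=
        (ContinuousOn.smul (by fun_prop) hgc).neg
      have h4 := (h3 0 Set.self_mem_Ici).mono_left (nhdsWithin_mono _ Set.Ioi_subset_Ici_self)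
      simpa using h4
    refine tendsto_nhds_unique h1 (h2.congr' ?_)
    filter_upwards [self_mem_nhdsWithin] with t ht using (hode2 t ht).symm
  have h1 : Tendsto x' (𝓝[>] 0) (𝓝 (x' 0)) :=
    (hx' 0 Set.self_mem_Ici).mono_left (nhdsWithin_mono _ Set.Ioi_subset_Ici_self)
  have hsx := hasDerivWithinAt_iff_tendsto_slope.1 hx
  have hsz := hasDerivWithinAt_iff_tendsto_slope.1 hz
  rw [Set.Ici_sdiff_left] at hsx hsz
  have h2 : x' 0 = r • (z' 0 - x' 0) := by
    refine tendsto_nhds_unique h1 (((hsz.sub hsx).const_smul r).congr' ?_)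
    filter_upwards [self_mem_nhdsWithin] with t ht
    rw [hode1 t ht, slope_def_module, slope_def_module, hxz, ← smul_sub, smul_smul,
      sub_zero, sub_sub_sub_cancel_right, div_eq_mul_inv]
  have h3 : (1 + r) • x' 0 = 0 := by
    rw [hz'0, zero_sub, smul_neg] at h2
    rw [add_smul, one_smul]
    nth_rewrite 1 [h2]
    simp
  exact (smul_eq_zero.1 h3).resolve_left (by positivity)

/-- Second-order form of the NAG ODE. -/
theorem nag_hasDerivAt_velocity {F : Type*} [NormedAddCommGroup F] [InnerProductSpace ℝ F]
    {r : ℝ} (hr : 0 < r) {x z x' z' g : ℝ → F} {t : ℝ} (ht : 0 < t)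
    (hx : HasDerivAt x (x' t) t) (hz : HasDerivAt z (z' t) t)
    (hode1 : ∀ t > (0 : ℝ), x' t = (r / t) • (z t - x t))
    (hode2 : z' t = -((t / r) • g t)) :
    HasDerivAt x' (-(((r + 1) / t) • x' t) - g t) t := by
  have h1 : HasDerivAt (fun s : ℝ => r / s) (-(r / t ^ 2)) t := by
    simpa [div_eq_mul_inv] using (hasDerivAt_inv ht.ne').const_mul r
  have h2 := (h1.smul (hz.sub hx)).congr_of_eventuallyEq
    (f₁ := x') (by
      filter_upwards [Ioi_mem_nhds ht] with s hs using hode1 s hs)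
  refine h2.congr_deriv ?_
  have h3 : z t - x t = (t / r) • x' t := by
    rw [hode1 t ht, smul_smul, div_mul_div_cancel₀ hr.ne', div_self ht.ne', one_smul]
  rw [hode2]
  simp only [Pi.sub_apply]
  rw [h3]
  match_scalars <;> field_simp
  ring

/-- The mechanical energy of the NAG ODE, tilted by `p`, is nonincreasing. -/
theorem antitoneOn_nag_energy {F : Type*} [NormedAddCommGroup F] [InnerProductSpace ℝ F]
    [CompleteSpace F] {r : ℝ} (hr : 0 < r) {f : F → ℝ} {x x' : ℝ → F} {p : F}
    (hgrad : ∀ y, HasGradientAt f (gradient f y) y) (hxc : ContinuousOn x (Set.Ici 0))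
    (hx' : ContinuousOn x' (Set.Ici 0)) (hfc : ContinuousOn (fun t => f (x t)) (Set.Ici 0))
    (hxd : ∀ t > 0, HasDerivAt x (x' t) t)
    (hx'd : ∀ t > 0, HasDerivAt x' (-(((r + 1) / t) • x' t) - gradient f (x t)) t)
    (hvar : ∀ t, 0 ≤ ⟪gradient f (x t) - p, p⟫_ℝ) :
    AntitoneOn (fun t => ‖x' t + (t / (r + 2)) • p‖ ^ 2 / 2 + (f (x t) - ⟪p, x t⟫_ℝ))
      (Set.Ici 0) := by
  refine antitoneOn_of_hasDerivWithinAt_nonpos (convex_Ici 0)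
    (f' := fun t => -((r + 1) / t) * ‖x' t + (t / (r + 2)) • p‖ ^ 2
      - t / (r + 2) * ⟪gradient f (x t) - p, p⟫_ℝ) ?_ ?_ ?_
  · exact (((hx'.add (by fun_prop)).norm.pow 2).div_const 2).add
      (hfc.sub (continuousOn_const.inner hxc))
  · intro t ht
    rw [interior_Ici] at ht
    have ht0 : t ≠ 0 := ne_of_gt ht
    have h1 := (hx'd t ht).add (((hasDerivAt_id t).div_const (r + 2)).smul_const p)
    have h2 := h1.norm_sq.div_const 2
    have h3 := (HasGradientAt.comp_hasDerivAt_inner (hgrad (x t)) (hxd t ht)).sub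
      ((hasDerivAt_const t p).inner ℝ (hxd t ht))
    refine ((h2.add h3).congr_deriv ?_).hasDerivWithinAt
    simp only [id, Pi.add_apply, ← real_inner_self_eq_norm_sq, inner_add_left, inner_add_right,
      inner_sub_right, inner_neg_right, real_inner_smul_left, real_inner_smul_right,
      inner_zero_left, real_inner_comm p, real_inner_comm (x' t) (gradient f (x t))]
    field_simp
    ring
  · intro t ht
    rw [interior_Ici] at ht
    have ht0 : 0 < t := ht
    have h1 : 0 ≤ (r + 1) / t * ‖x' t + (t / (r + 2)) • p‖ ^ 2 := by positivity
    have h2 := mul_nonneg (show 0 ≤ t / (r + 2) by positivity) (hvar t)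
    linarith

/-- for a solution `(x, z)` of the NAG ODE with parameter `r`, define
`q(t) := −(2(r+2)/t²)(x(t) − x₀)`.  Then (a) `q(t) ∈ dom f*` for all `t > 0`;
(b) if `p⋆ ∈ dom f*`, then `‖q(t) − p⋆‖² ≤ 8(r+2)² D_f(x₀,p⋆)/t²` for all `t > 0`. -/
theorem stmt11 {n : ℕ} (hn : 1 ≤ n) (L : ℝ) (hL : 0 < L)
    (f : EuclideanSpace ℝ (Fin n) → ℝ) (hf : LSmoothConvex L f)
    (r : ℝ) (hr : 0 < r) (x₀ : EuclideanSpace ℝ (Fin n))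
    (x z x' z' : ℝ → EuclideanSpace ℝ (Fin n))
    (hx : ∀ t ∈ Set.Ici (0 : ℝ), HasDerivWithinAt x (x' t) (Set.Ici 0) t)
    (hx' : ContinuousOn x' (Set.Ici 0))
    (hz : ∀ t ∈ Set.Ici (0 : ℝ), HasDerivWithinAt z (z' t) (Set.Ici 0) t)
    (hz' : ContinuousOn z' (Set.Ici 0))
    (hx0 : x 0 = x₀) (hz0 : z 0 = x₀)
    (hode1 : ∀ t > (0 : ℝ), x' t = (r / t) • (z t - x t))
    (hode2 : ∀ t > (0 : ℝ), z' t = -((t / r) • gradient f (x t)))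
    (pstar : EuclideanSpace ℝ (Fin n))
    (hps : pstar ∈ closure (fconjDom f))
    (hmin : ∀ q ∈ closure (fconjDom f), ‖pstar‖ ≤ ‖q‖) :
    (∀ t > (0 : ℝ), -((2 * (r + 2) / t ^ 2) • (x t - x₀)) ∈ fconjDom f) ∧
    (pstar ∈ fconjDom f → ∀ t > (0 : ℝ),
      ‖-((2 * (r + 2) / t ^ 2) • (x t - x₀)) - pstar‖ ^ 2 ≤
        8 * (r + 2) ^ 2 * dualDiv f x₀ pstar / t ^ 2) := by
  obtain ⟨hconv, hdiff, hlip⟩ := hf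
  have hgrad : ∀ y, HasGradientAt f (gradient f y) y := fun y => (hdiff y).hasGradientAt
  have hfen : ∀ u y, ⟪gradient f u, y⟫_ℝ - f y ≤ ⟪gradient f u, u⟫_ℝ - f u := fun u y => by
    have := hconv.inner_le_sub_of_hasGradientAt (hgrad u) y
    rw [inner_sub_right] at this
    linarith
  have hxc : ContinuousOn x (Set.Ici 0) := fun t ht => (hx t ht).continuousWithinAt
  have hzc : ContinuousOn z (Set.Ici 0) := fun t ht => (hz t ht).continuousWithinAt
  have hgc : ContinuousOn (fun t => gradient f (x t)) (Set.Ici 0) :=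
    hlip.continuous.comp_continuousOn hxc
  have hfc : ContinuousOn (fun t => f (x t)) (Set.Ici 0) :=
    hdiff.continuous.comp_continuousOn hxc
  have hxd : ∀ t > 0, HasDerivAt x (x' t) t := fun t ht =>
    (hx t ht.le).hasDerivAt (Ici_mem_nhds ht)
  have hzd : ∀ t > 0, HasDerivAt z (z' t) t := fun t ht =>
    (hz t ht.le).hasDerivAt (Ici_mem_nhds ht)
  refine ⟨fun T hT => ?_, fun hp T hT => ?_⟩
  · obtain ⟨M, hM⟩ := isCompact_Icc.bddAbove_image (K := Set.Icc 0 T)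
      (((hgc.inner hxc).sub hfc).mono Set.Icc_subset_Ici_self)
    have hM' : ∀ s ∈ Set.Icc 0 T, ∀ y, ⟪gradient f (x s), y⟫_ℝ - f y ≤ M := fun s hs y =>
      (hfen _ y).trans (hM (Set.mem_image_of_mem _ hs))
    refine mem_fconjDom_of_forall_le (M := M) fun y => ?_
    have hxy := nag_inner_sub_add_nonneg hr hT hxc hzc hxd hzd hx0 hz0 hode1 hode2 (y := y)
      (b := f y + M) fun s hs => by linarith [hM' s ⟨hs.1.le, hs.2.le⟩ y]
    have h3 := mul_nonneg (show 0 ≤ 2 * (r + 2) / T ^ 2 by positivity) hxy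
    have h4 : 2 * (r + 2) / T ^ 2 * (⟪x T - x₀, y⟫_ℝ + T ^ 2 / (2 * (r + 2)) * (f y + M)) =
        2 * (r + 2) / T ^ 2 * ⟪x T - x₀, y⟫_ℝ + (f y + M) := by
      field_simp
    rw [inner_neg_left, real_inner_smul_left]
    linarith
  · have hx'0 : x' 0 = 0 :=
    nag_initial_velocity_eq_zero hr (hx 0 Set.self_mem_Ici) (hz 0 Set.self_mem_Ici)
      hx' hz' (hx0.trans hz0.symm) hgc hode1 hode2
    have hx'd : ∀ t > 0,
        HasDerivAt x' (-(((r + 1) / t) • x' t) - gradient f (x t)) t := fun t ht =>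
      nag_hasDerivAt_velocity (g := fun t => gradient f (x t)) hr ht (hxd t ht) (hzd t ht)
        hode1 (hode2 t ht)
    have hvar : ∀ t, 0 ≤ ⟪gradient f (x t) - pstar, pstar⟫_ℝ := fun t =>
      (convex_fconjDom f).inner_sub_nonneg_of_norm_le hp
        (fun q hq => hmin q (subset_closure hq)) (mem_fconjDom_of_forall_le (hfen (x t)))
    have henergy := antitoneOn_nag_energy (p := pstar) hr hgrad hxc hx' hfc hxd hx'd hvar
    set D := dualDiv f x₀ pstar with hD
    have hD0 : 0 ≤ D := dualDiv_nonneg hp x₀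
    have hV : ∀ t ∈ Set.Ici (0 : ℝ), ‖x' t + (t / (r + 2)) • pstar‖ ≤ √(2 * D) := by
      intro t ht
      refine Real.le_sqrt_of_sq_le ?_
      have h1 := henergy Set.self_mem_Ici ht ht
      have h2 := dualDiv_nonneg hp (x t)
      simp only [hx'0, hx0, zero_div, zero_smul, add_zero, norm_zero] at h1
      unfold dualDiv at hD h2
      linarith
    have hX : ‖x T - x₀ + (T ^ 2 / (2 * (r + 2))) • pstar‖ ≤ √(2 * D) * T := by
      have h := norm_image_sub_le_of_norm_deriv_le_segment' (a := 0) (b := T)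
        (f := fun t => x t + (t ^ 2 / (2 * (r + 2))) • pstar)
        (f' := fun t => x' t + (t / (r + 2)) • pstar) (C := √(2 * D)) (fun t ht => ?_)
        (fun t ht => hV t ht.1) T ⟨hT.le, le_rfl⟩
      · simpa [hx0, sub_add_eq_add_sub] using h
      · refine ((hx t ht.1).mono Set.Icc_subset_Ici_self).add ?_
        have h2 := (((hasDerivAt_id t).pow 2).div_const (2 * (r + 2))).smul_const pstar
        refine (h2.congr_deriv ?_).hasDerivWithinAt
        congr 1
        simp
        field_simp
    have hq : -((2 * (r + 2) / T ^ 2) • (x T - x₀)) - pstar =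
        -((2 * (r + 2) / T ^ 2) • (x T - x₀ + (T ^ 2 / (2 * (r + 2))) • pstar)) := by
      rw [smul_add, smul_smul, div_mul_div_cancel₀ (by positivity), div_self (by positivity),
        one_smul, neg_add']
    rw [hq, norm_neg, norm_smul, mul_pow, Real.norm_eq_abs, sq_abs]
    have h1 : ‖x T - x₀ + (T ^ 2 / (2 * (r + 2))) • pstar‖ ^ 2 ≤ 2 * D * T ^ 2 := by
      calc _ ≤ (√(2 * D) * T) ^ 2 := by gcongr
        _ = _ := by rw [mul_pow, Real.sq_sqrt (by positivity)]
    calc _ ≤ (2 * (r + 2) / T ^ 2) ^ 2 * (2 * D * T ^ 2) := by gcongr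
      _ = _ := by field_simp; ring
end

section
/- Let f : ℝ^n → ℝ be L-smooth convex for some L > 0, and let (x, z) be a solution of the NAG ODE with parameter r = 2 and initial point x₀. For w ∈ ℝ^n define the energy function 𝒱_w(t) := (t²/2)(g(x(t)) − g(w)) + ‖z(t) + (t²/4)p⋆ − w‖² for t ≥ 0. Then 𝒱_w is continuously differentiable on [0,∞), and for every t > 0 its derivative satisfies 𝒱_w'(t) ≤ −(t³/4)⟨∇g(x(t)), p⋆⟩ ≤ 0; in particular 𝒱_w is nonincreasing on [0,∞). -/
open scoped InnerProductSpace
open Filter Topology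

theorem mem_fconjDom_iff {n : ℕ} {f : EuclideanSpace ℝ (Fin n) → ℝ}
    {p : EuclideanSpace ℝ (Fin n)} :
    p ∈ fconjDom f ↔ ∃ C : ℝ, ∀ x, ⟪p, x⟫_ℝ - f x ≤ C := by
  constructor
  · intro h
    obtain ⟨C, hC, -⟩ := EReal.lt_iff_exists_real_btwn.1 (show fconj f p < ⊤ from h)
    exact ⟨C, fun x => EReal.coe_le_coe_iff.1 ((le_iSup (fun x : EuclideanSpace ℝ (Fin n) =>
      ((⟪p, x⟫_ℝ - f x : ℝ) : EReal)) x).trans hC.le)⟩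
  · rintro ⟨C, hC⟩
    exact (iSup_le fun x => EReal.coe_le_coe_iff.2 (hC x)).trans_lt (EReal.coe_lt_top C)

section InnerProduct

variable {E : Type*} [NormedAddCommGroup E] [InnerProductSpace ℝ E]

/-- The first-order (gradient) inequality for a convex function. -/
theorem ConvexOn.add_inner_sub_le_of_hasGradientAt [CompleteSpace E] {f : E → ℝ}
    (hf : ConvexOn ℝ Set.univ f) {x v : E} (hv : HasGradientAt f v x) (y : E) :
    f x + ⟪v, y - x⟫_ℝ ≤ f y := by
  have hline : HasDerivAt (fun t : ℝ => f (AffineMap.lineMap x y t)) ⟪v, y - x⟫_ℝ 0 := by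
    have h : HasFDerivAt f (InnerProductSpace.toDual ℝ E v) (AffineMap.lineMap x y (0 : ℝ)) := by
      simpa using hv.hasFDerivAt
    simpa [Function.comp_def] using h.comp_hasDerivAt (0 : ℝ) AffineMap.hasDerivAt_lineMap
  have hconv : ConvexOn ℝ Set.univ (fun t : ℝ => f (AffineMap.lineMap x y t)) := by
    simpa using! hf.comp_affineMap (AffineMap.lineMap x y)
  have h := hconv.le_slope_of_hasDerivAt (Set.mem_univ 0) (Set.mem_univ 1) zero_lt_one hline
  simp [slope_def_field] at h
  linarith

theorem Convex.inner_sub_nonneg_of_forall_norm_le {K : Set E} (hK : Convex ℝ K) {p q : E}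
    (hp : p ∈ K) (hmin : ∀ y ∈ K, ‖p‖ ≤ ‖y‖) (hq : q ∈ K) : 0 ≤ ⟪q - p, p⟫_ℝ := by
  have : Nonempty K := ⟨⟨p, hp⟩⟩
  have hinf : ‖0 - p‖ = ⨅ y : K, ‖(0 : E) - y‖ := by
    refine le_antisymm (le_ciInf fun y => by simpa using hmin y y.2) ?_
    exact ciInf_le ⟨0, by rintro _ ⟨y, rfl⟩; positivity⟩ (⟨p, hp⟩ : K)
  have h := (norm_eq_iInf_iff_real_inner_le_zero hK hp).1 hinf q hq
  rw [zero_sub, inner_neg_left, real_inner_comm] at h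
  linarith

theorem HasGradientAt.sub_inner [CompleteSpace E] {f : E → ℝ} {x v : E}
    (hf : HasGradientAt f v x) (p : E) :
    HasGradientAt (fun y => f y - ⟪p, y⟫_ℝ) (v - p) x := by
  rw [hasGradientAt_iff_hasFDerivAt, map_sub]
  exact hf.hasFDerivAt.sub (InnerProductSpace.toDual ℝ E p).hasFDerivAt

end InnerProduct

/-- The gradients of a convex function lie in the domain of its conjugate. -/
theorem ConvexOn.mem_fconjDom_of_hasGradientAt {n : ℕ} {f : EuclideanSpace ℝ (Fin n) → ℝ}
    (hf : ConvexOn ℝ Set.univ f) {x v : EuclideanSpace ℝ (Fin n)} (hv : HasGradientAt f v x) :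
    v ∈ fconjDom f := by
  refine mem_fconjDom_iff.2 ⟨⟪v, x⟫_ℝ - f x, fun y => ?_⟩
  have h := hf.add_inner_sub_le_of_hasGradientAt hv y
  rw [inner_sub_right] at h
  linarith

/-- for a solution `(x, z)` of the NAG ODE with parameter `r = 2`, the
energy `𝒱_w(t) = (t²/2)(g(x(t)) − g(w)) + ‖z(t) + (t²/4)p⋆ − w‖²` (with
`g(y) = f(y) − ⟪p⋆, y⟫`) is C¹ on `[0,∞)` with
`𝒱_w'(t) ≤ −(t³/4)⟪∇g(x(t)), p⋆⟫ ≤ 0` for `t > 0`; in particular it is nonincreasing. -/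
theorem stmt12 {n : ℕ} (hn : 1 ≤ n) (L : ℝ) (hL : 0 < L)
    (f : EuclideanSpace ℝ (Fin n) → ℝ) (hf : LSmoothConvex L f)
    (x₀ : EuclideanSpace ℝ (Fin n))
    (x z x' z' : ℝ → EuclideanSpace ℝ (Fin n))
    (hx : ∀ t ∈ Set.Ici (0 : ℝ), HasDerivWithinAt x (x' t) (Set.Ici 0) t)
    (hx' : ContinuousOn x' (Set.Ici 0))
    (hz : ∀ t ∈ Set.Ici (0 : ℝ), HasDerivWithinAt z (z' t) (Set.Ici 0) t)
    (hz' : ContinuousOn z' (Set.Ici 0))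
    (hx0 : x 0 = x₀) (hz0 : z 0 = x₀)
    (hode1 : ∀ t > (0 : ℝ), x' t = ((2 : ℝ) / t) • (z t - x t))
    (hode2 : ∀ t > (0 : ℝ), z' t = -((t / 2) • gradient f (x t)))
    (pstar : EuclideanSpace ℝ (Fin n))
    (hps : pstar ∈ closure (fconjDom f))
    (hmin : ∀ q ∈ closure (fconjDom f), ‖pstar‖ ≤ ‖q‖)
    (w : EuclideanSpace ℝ (Fin n)) :
    ∃ Vd : ℝ → ℝ,
      (∀ t ∈ Set.Ici (0 : ℝ),
        HasDerivWithinAt (fun t : ℝ =>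
          (t ^ 2 / 2) * ((f (x t) - ⟪pstar, x t⟫_ℝ) - (f w - ⟪pstar, w⟫_ℝ)) +
            ‖z t + (t ^ 2 / 4) • pstar - w‖ ^ 2) (Vd t) (Set.Ici 0) t) ∧
      ContinuousOn Vd (Set.Ici 0) ∧
      (∀ t > (0 : ℝ),
        Vd t ≤ -(t ^ 3 / 4) *
          ⟪gradient (fun y => f y - ⟪pstar, y⟫_ℝ) (x t), pstar⟫_ℝ) ∧
      (∀ t > (0 : ℝ),
        -(t ^ 3 / 4) *
          ⟪gradient (fun y => f y - ⟪pstar, y⟫_ℝ) (x t), pstar⟫_ℝ ≤ 0) ∧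
      AntitoneOn (fun t : ℝ =>
        (t ^ 2 / 2) * ((f (x t) - ⟪pstar, x t⟫_ℝ) - (f w - ⟪pstar, w⟫_ℝ)) +
          ‖z t + (t ^ 2 / 4) • pstar - w‖ ^ 2) (Set.Ici 0) := by
  obtain ⟨hconv, hdiff, hlip⟩ := hf
  have hgrad : ∀ y, HasGradientAt f (gradient f y) y := fun y => (hdiff y).hasGradientAt
  have hgradg : ∀ y, gradient (fun y => f y - ⟪pstar, y⟫_ℝ) y = gradient f y - pstar :=
    fun y => ((hgrad y).sub_inner pstar).gradient
  have hinner : ∀ y, 0 ≤ ⟪gradient f y - pstar, pstar⟫_ℝ := fun y =>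
    (convex_fconjDom f).closure.inner_sub_nonneg_of_forall_norm_le hps hmin
      (subset_closure (hconv.mem_fconjDom_of_hasGradientAt (hgrad y)))
  have hcx : ContinuousOn x (Set.Ici 0) := fun t ht => (hx t ht).continuousWithinAt
  have hcz : ContinuousOn z (Set.Ici 0) := fun t ht => (hz t ht).continuousWithinAt
  have hcf : ContinuousOn (fun t => f (x t)) (Set.Ici 0) := hdiff.continuous.comp_continuousOn hcx
  have hcg : ContinuousOn (fun t => gradient f (x t)) (Set.Ici 0) :=
    hlip.continuous.comp_continuousOn hcx
  set Vd : ℝ → ℝ := fun t =>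
    t * ((f (x t) - ⟪pstar, x t⟫_ℝ) - (f w - ⟪pstar, w⟫_ℝ)) +
      t ^ 2 / 2 * ⟪gradient f (x t) - pstar, x' t⟫_ℝ +
      2 * ⟪z t + (t ^ 2 / 4) • pstar - w, z' t + (t / 2) • pstar⟫_ℝ with hVd
  have hderiv : ∀ t ∈ Set.Ici (0 : ℝ), HasDerivWithinAt (fun t : ℝ =>
      (t ^ 2 / 2) * ((f (x t) - ⟪pstar, x t⟫_ℝ) - (f w - ⟪pstar, w⟫_ℝ)) +
        ‖z t + (t ^ 2 / 4) • pstar - w‖ ^ 2) (Vd t) (Set.Ici 0) t := by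
    intro t ht
    have hg : HasDerivWithinAt (fun t => f (x t) - ⟪pstar, x t⟫_ℝ)
        ⟪gradient f (x t) - pstar, x' t⟫_ℝ (Set.Ici 0) t :=
      ((hgrad (x t)).sub_inner pstar).hasFDerivAt.comp_hasDerivWithinAt t (hx t ht)
    have hsq : ∀ c : ℝ, HasDerivWithinAt (fun t : ℝ => t ^ 2 / c) (2 * t / c) (Set.Ici 0) t :=
      fun c => by simpa using ((hasDerivAt_pow 2 t).div_const c).hasDerivWithinAt
    have hn := (((hz t ht).add ((hsq 4).smul_const pstar)).sub_const w).norm_sq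
    refine (((hsq 2).mul (hg.sub_const (f w - ⟪pstar, w⟫_ℝ))).add hn).congr_deriv ?_
    have h4 : 2 * t / 4 = t / 2 := by ring
    simp only [hVd, h4, Pi.add_apply]
    ring
  have hcont : ContinuousOn Vd (Set.Ici 0) := by
    have hpx : ContinuousOn (fun t => ⟪pstar, x t⟫_ℝ) (Set.Ici 0) :=
      ContinuousOn.inner (𝕜 := ℝ) continuousOn_const hcx
    have hgx' : ContinuousOn (fun t => ⟪gradient f (x t) - pstar, x' t⟫_ℝ) (Set.Ici 0) :=
      (hcg.sub continuousOn_const).inner (𝕜 := ℝ) hx'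
    have hzz' : ContinuousOn (fun t : ℝ =>
        ⟪z t + (t ^ 2 / 4) • pstar - w, z' t + (t / 2) • pstar⟫_ℝ) (Set.Ici 0) :=
      ContinuousOn.inner (𝕜 := ℝ) (by fun_prop) (by fun_prop)
    refine ((continuousOn_id.mul ((hcf.sub hpx).sub continuousOn_const)).add
      (ContinuousOn.mul ?_ hgx')).add (continuousOn_const.mul hzz')
    fun_prop
  have hle : ∀ t > (0 : ℝ), Vd t ≤ -(t ^ 3 / 4) * ⟪gradient f (x t) - pstar, pstar⟫_ℝ := by
    intro t ht
    have hfirst := hconv.add_inner_sub_le_of_hasGradientAt (hgrad (x t)) w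
    have hz't : z' t + (t / 2) • pstar = -(t / 2) • (gradient f (x t) - pstar) := by
      rw [hode2 t ht]; module
    have hVt : Vd t = t * (f (x t) + ⟪gradient f (x t), w - x t⟫_ℝ - f w) -
        t ^ 3 / 4 * ⟪gradient f (x t) - pstar, pstar⟫_ℝ := by
      simp only [hVd]
      rw [hz't, hode1 t ht]
      simp only [inner_sub_left, inner_sub_right, inner_add_left, inner_smul_left,
        inner_smul_right, RCLike.conj_to_real]
      rw [real_inner_comm (gradient f (x t)) (z t), real_inner_comm (gradient f (x t)) w,
        real_inner_comm (gradient f (x t)) pstar, real_inner_comm pstar (z t),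
        real_inner_comm pstar w]
      field_simp
      ring
    rw [hVt]
    nlinarith
  have hneg : ∀ t > (0 : ℝ), -(t ^ 3 / 4) * ⟪gradient f (x t) - pstar, pstar⟫_ℝ ≤ 0 :=
    fun t ht => mul_nonpos_of_nonpos_of_nonneg (by have := pow_pos ht 3; linarith) (hinner _)
  simp only [hgradg]
  refine ⟨Vd, hderiv, hcont, hle, hneg, ?_⟩
  refine antitoneOn_of_hasDerivWithinAt_nonpos (f' := Vd) (convex_Ici 0)
    (fun t ht => (hderiv t ht).continuousWithinAt) (fun t ht => ?_) (fun t ht => ?_)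
  · exact (hderiv t (interior_subset ht)).mono interior_subset
  · rw [interior_Ici, Set.mem_Ioi] at ht
    exact (hle t ht).trans (hneg t ht)
end
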